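/- (Concavity of the sandwiched Rényi auxiliary function E_0^{(1),*}(s,P) on (−1,0).) The map s ↦ s·I^{(1),*}_{1/(1+s)}(P,W) is concave on the interval (−1,0); note that 1/(1+s) ∈ (1,∞) for s ∈ (−1,0). -/

import Mathlib

open Matrix
open scoped ComplexOrder

/-- Real power of a (hermitian) matrix via the continuous functional calculus. -/
noncomputable def mpow {ι : Type*} [Fintype ι] [DecidableEq ι]
    (A : Matrix ι ι ℂ) (r : ℝ) : Matrix ι ι ℂ :=
  cfc (fun x : ℝ => x ^ r) A

/-- Logarithm of a (hermitian) matrix via the continuous functional calculus. -/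
noncomputable def mlog {ι : Type*} [Fintype ι] [DecidableEq ι]
    (A : Matrix ι ι ℂ) : Matrix ι ι ℂ :=
  cfc Real.log A

/-- Real part of the trace. -/
noncomputable def trR {ι : Type*} [Fintype ι] (A : Matrix ι ι ℂ) : ℝ :=
  (Matrix.trace A).re

/-- Positive definite density matrices. -/
def Dens (d : ℕ) : Type :=
  {σ : Matrix (Fin d) (Fin d) ℂ // σ.PosDef ∧ σ.trace = 1}

/-- Sandwiched Rényi information of order `α ≠ 1`. -/
noncomputable def sandwichedRenyiInfo {d n : ℕ} (α : ℝ)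
    (W : Fin n → Matrix (Fin d) (Fin d) ℂ) (P : Fin n → ℝ) : ℝ :=
  ⨅ σ : Dens d, (1 / (α - 1)) * Real.log (∑ i, P i *
    trR (mpow (mpow σ.1 ((1 - α) / (2 * α)) * W i * mpow σ.1 ((1 - α) / (2 * α))) α))

section Helpers

variable {ι : Type*} [Fintype ι]

/-- The real quadratic form of a matrix. -/
noncomputable def quadRe (A : Matrix ι ι ℂ) (v : ι → ℂ) : ℝ :=
  (star v ⬝ᵥ (A *ᵥ v)).re

lemma quadRe_nonneg {A : Matrix ι ι ℂ} (hA : A.PosSemidef) (v : ι → ℂ) : 0 ≤ quadRe A v :=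
  hA.re_dotProduct_nonneg v

lemma quadRe_conj (A L : Matrix ι ι ℂ) (v : ι → ℂ) :
    quadRe (Lᴴ * A * L) v = quadRe A (L *ᵥ v) := by
  simp only [quadRe, star_mulVec, ← mulVec_mulVec, dotProduct_mulVec, vecMul_vecMul]

lemma quadRe_smul (c : ℝ) (A : Matrix ι ι ℂ) (v : ι → ℂ) :
    quadRe (c • A) v = c * quadRe A v := by
  simp [quadRe, smul_mulVec, dotProduct_smul]

variable [DecidableEq ι]

lemma quadRe_diagonal (l : ι → ℝ) (v : ι → ℂ) :
    quadRe (diagonal fun i => (l i : ℂ)) v = ∑ i, Complex.normSq (v i) * l i := by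
  simp only [quadRe, dotProduct, mulVec_diagonal, Complex.re_sum, Pi.star_apply]
  refine Finset.sum_congr rfl fun i _ => ?_
  simp [Complex.normSq_apply]
  ring

lemma trR_cfc {A : Matrix ι ι ℂ} (hA : A.IsHermitian) (f : ℝ → ℝ) :
    trR (cfc f A) = ∑ i, f (hA.eigenvalues i) := by
  rw [hA.cfc_eq, IsHermitian.cfc, Unitary.conjStarAlgAut_apply, trR, trace_mul_cycle,
    Unitary.coe_star_mul_self, one_mul, trace_diagonal]
  simp

lemma trR_mpow {A : Matrix ι ι ℂ} (hA : A.IsHermitian) (r : ℝ) :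
    trR (mpow A r) = ∑ i, hA.eigenvalues i ^ r :=
  trR_cfc hA _

lemma trR_mpow_congr {A B : Matrix ι ι ℂ} (hA : A.IsHermitian) (hB : B.IsHermitian)
    (h : A.charpoly = B.charpoly) (r : ℝ) : trR (mpow A r) = trR (mpow B r) := by
  rw [trR_mpow hA, trR_mpow hB, (hA.eigenvalues_eq_eigenvalues_iff hB).2 h]

lemma spectral_conj {A : Matrix ι ι ℂ} (hA : A.IsHermitian) :
    A = (hA.eigenvectorUnitary : Matrix ι ι ℂ) * diagonal (fun i => (hA.eigenvalues i : ℂ)) *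
      (hA.eigenvectorUnitary : Matrix ι ι ℂ)ᴴ := by
  conv_lhs => rw [hA.spectral_theorem, Unitary.conjStarAlgAut_apply]
  rfl

/-- Peierls' inequality for powers: diagonal entries in any orthonormal basis. -/
lemma sum_quadRe_rpow_le {A U : Matrix ι ι ℂ} (hA : A.PosSemidef)
    (hU : U ∈ unitaryGroup ι ℂ) {r : ℝ} (hr : 1 ≤ r) :
    ∑ k, quadRe A (fun i => U i k) ^ r ≤ trR (mpow A r) := by
  set V : Matrix ι ι ℂ := (hA.1.eigenvectorUnitary : Matrix ι ι ℂ)ᴴ with hV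
  have hVU : V ∈ unitaryGroup ι ℂ := (star hA.1.eigenvectorUnitary).2
  set X := V * U with hX
  have hXU : X ∈ unitaryGroup ι ℂ := mul_mem hVU hU
  have hq (k : ι) : quadRe A (fun i => U i k) =
      ∑ j, Complex.normSq (X j k) * hA.1.eigenvalues j := by
    have h1 : A = Vᴴ * diagonal (fun i => (hA.1.eigenvalues i : ℂ)) * V := by
      rw [hV, conjTranspose_conjTranspose]
      exact spectral_conj hA.1
    conv_lhs => rw [h1]
    rw [quadRe_conj, quadRe_diagonal]
    rfl
  have hcol (k : ι) : ∑ j, Complex.normSq (X j k) = 1 := by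
    have := congrFun (congrFun (mem_unitaryGroup_iff'.1 hXU) k) k
    simp only [mul_apply, star_apply, one_apply_eq] at this
    rw [← Complex.ofReal_inj, Complex.ofReal_sum, Complex.ofReal_one, ← this]
    exact Finset.sum_congr rfl fun j _ => Complex.normSq_eq_conj_mul_self
  have hrow (j : ι) : ∑ k, Complex.normSq (X j k) = 1 := by
    have := congrFun (congrFun (mem_unitaryGroup_iff.1 hXU) j) j
    simp only [mul_apply, star_apply, one_apply_eq] at this
    rw [← Complex.ofReal_inj, Complex.ofReal_sum, Complex.ofReal_one, ← this]
    exact Finset.sum_congr rfl fun k _ => Complex.normSq_eq_conj_mul_self.trans (mul_comm _ _)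
  calc ∑ k, quadRe A (fun i => U i k) ^ r
      ≤ ∑ k, ∑ j, Complex.normSq (X j k) * hA.1.eigenvalues j ^ r := by
        refine Finset.sum_le_sum fun k _ => ?_
        rw [hq]
        exact Real.rpow_arith_mean_le_arith_mean_rpow _ _ _ (fun _ _ => Complex.normSq_nonneg _)
          (hcol k) (fun j _ => hA.eigenvalues_nonneg j) hr
    _ = trR (mpow A r) := by
        rw [Finset.sum_comm, trR_mpow hA.1]
        simp_rw [← Finset.sum_mul, hrow, one_mul]

omit [DecidableEq ι] in
/-- Weighted Hölder inequality for interpolating exponents. -/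
lemma sum_rpow_le_of_le_geom {w c e g : ι → ℝ} (hw : ∀ k, 0 ≤ w k) (hc : ∀ k, 0 ≤ c k)
    (he : ∀ k, 0 ≤ e k) (hg : ∀ k, 0 ≤ g k) {a b r r₀ r₁ : ℝ} (ha : 0 < a) (hb : 0 < b)
    (hr : 0 < r) (hr₀ : 0 < r₀) (hr₁ : 0 < r₁) (h : a / r₀ + b / r₁ = 1 / r)
    (hgeom : ∀ k, g k ≤ c k ^ a * e k ^ b) :
    ∑ k, w k * g k ^ r ≤
      (∑ k, w k * c k ^ r₀) ^ (a * r / r₀) * (∑ k, w k * e k ^ r₁) ^ (b * r / r₁) := by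
  have hT : (r₀ / a).HolderTriple (r₁ / b) r :=
    ⟨by rw [inv_div, inv_div, h, one_div], by positivity, by positivity⟩
  have key := Real.Lr_rpow_le_Lp_mul_Lq_of_nonneg Finset.univ hT
    (f := fun k => w k ^ (a / r₀) * c k ^ a) (g := fun k => w k ^ (b / r₁) * e k ^ b)
    (fun k _ => mul_nonneg (Real.rpow_nonneg (hw k) _) (Real.rpow_nonneg (hc k) _))
    (fun k _ => mul_nonneg (Real.rpow_nonneg (hw k) _) (Real.rpow_nonneg (he k) _))
  have hpow {x y s t : ℝ} (hx : 0 ≤ x) (hy : 0 ≤ y) (hs : 0 < s) (ht : 0 < t) :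
      (x ^ (s / t) * y ^ s) ^ (t / s) = x * y ^ t := by
    rw [Real.mul_rpow (by positivity) (by positivity), ← Real.rpow_mul hx, ← Real.rpow_mul hy]
    congr 1
    · rw [show s / t * (t / s) = 1 by field_simp, Real.rpow_one]
    · rw [show s * (t / s) = t by field_simp]
  simp only [hpow (hw _) (hc _) ha hr₀, hpow (hw _) (he _) hb hr₁] at key
  rw [show a * r / r₀ = r / (r₀ / a) by field_simp, show b * r / r₁ = r / (r₁ / b) by field_simp]
  refine le_trans (Finset.sum_le_sum fun k _ => ?_) key
  have h2 : w k ^ (a / r₀) * c k ^ a * (w k ^ (b / r₁) * e k ^ b) =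
      w k ^ (1 / r) * (c k ^ a * e k ^ b) := by
    rw [← h, Real.rpow_add' (hw k) (by positivity)]
    ring
  have hce : 0 ≤ c k ^ a * e k ^ b :=
    mul_nonneg (Real.rpow_nonneg (hc k) _) (Real.rpow_nonneg (he k) _)
  rw [h2, Real.mul_rpow (Real.rpow_nonneg (hw k) _) hce, ← Real.rpow_mul (hw k),
    one_div_mul_cancel hr.ne', Real.rpow_one]
  exact mul_le_mul_of_nonneg_left (Real.rpow_le_rpow (hg k) (hgeom k) hr.le) (hw k)

/-- Trace interpolation: a pointwise geometric-mean bound of quadratic forms implies a Hölder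
bound for Schatten-type sums. -/
lemma sum_trR_mpow_le_of_quadRe_le {m : Type*} [Fintype m] {P : m → ℝ} (hP : ∀ i, 0 ≤ P i)
    {G C D : m → Matrix ι ι ℂ} (hG : ∀ i, (G i).PosSemidef) (hC : ∀ i, (C i).PosSemidef)
    (hD : ∀ i, (D i).PosSemidef) {a b r r₀ r₁ : ℝ} (ha : 0 < a) (hb : 0 < b)
    (hr : 0 < r) (hr₀ : 1 ≤ r₀) (hr₁ : 1 ≤ r₁) (h : a / r₀ + b / r₁ = 1 / r)
    (hq : ∀ i v, quadRe (G i) v ≤ quadRe (C i) v ^ a * quadRe (D i) v ^ b) :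
    ∑ i, P i * trR (mpow (G i) r) ≤ (∑ i, P i * trR (mpow (C i) r₀)) ^ (a * r / r₀) *
      (∑ i, P i * trR (mpow (D i) r₁)) ^ (b * r / r₁) := by
  let V (i : m) (k : ι) : ι → ℂ := fun j => ((hG i).1.eigenvectorUnitary : Matrix ι ι ℂ) j k
  have hev (i : m) (k : ι) : (hG i).1.eigenvalues k = quadRe (G i) (V i k) :=
    (hG i).1.eigenvalues_eq k
  have key := sum_rpow_le_of_le_geom (ι := m × ι) (w := fun x => P x.1)
    (c := fun x => quadRe (C x.1) (V x.1 x.2)) (e := fun x => quadRe (D x.1) (V x.1 x.2))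
    (g := fun x => quadRe (G x.1) (V x.1 x.2))
    (fun _ => hP _) (fun _ => quadRe_nonneg (hC _) _) (fun _ => quadRe_nonneg (hD _) _)
    (fun _ => quadRe_nonneg (hG _) _) ha hb hr (by linarith) (by linarith) h (fun _ => hq _ _)
  simp only [Fintype.sum_prod_type, ← Finset.mul_sum] at key
  simp only [trR_mpow (hG _).1, hev]
  refine key.trans ?_
  have hbound {M : m → Matrix ι ι ℂ} (hM : ∀ i, (M i).PosSemidef) {s : ℝ} (hs : 1 ≤ s) :
      ∑ i, P i * ∑ k, quadRe (M i) (V i k) ^ s ≤ ∑ i, P i * trR (mpow (M i) s) :=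
    Finset.sum_le_sum fun i _ => mul_le_mul_of_nonneg_left
      (sum_quadRe_rpow_le (hM i) (hG i).1.eigenvectorUnitary.2 hs) (hP i)
  have hnn {M : m → Matrix ι ι ℂ} (hM : ∀ i, (M i).PosSemidef) (s : ℝ) :
      0 ≤ ∑ i, P i * ∑ k, quadRe (M i) (V i k) ^ s :=
    Finset.sum_nonneg fun i _ => mul_nonneg (hP i) <| Finset.sum_nonneg fun k _ =>
      Real.rpow_nonneg (quadRe_nonneg (hM i) _) _
  exact mul_le_mul (Real.rpow_le_rpow (hnn hC _) (hbound hC hr₀) (by positivity))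
    (Real.rpow_le_rpow (hnn hD _) (hbound hD hr₁) (by positivity))
    (Real.rpow_nonneg (hnn hD _) _)
    (Real.rpow_nonneg ((hnn hC _).trans (hbound hC hr₀)) _)

lemma cfc_mul_cfc {A : Matrix ι ι ℂ} (f g : ℝ → ℝ) :
    cfc f A * cfc g A = cfc (fun x => f x * g x) A :=
  (cfc_mul f g A (A.finite_real_spectrum.continuousOn _)
    (A.finite_real_spectrum.continuousOn _)).symm

lemma cfc_cfc {A : Matrix ι ι ℂ} (hA : A.IsHermitian) (g f : ℝ → ℝ) :
    cfc g (cfc f A) = cfc (fun x => g (f x)) A :=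
  (cfc_comp' g f A ((A.finite_real_spectrum.image f).continuousOn _)
    (A.finite_real_spectrum.continuousOn _) hA).symm

lemma spectrum_pos {A : Matrix ι ι ℂ} (hA : A.PosDef) {x : ℝ} (hx : x ∈ spectrum ℝ A) :
    0 < x := by
  rw [hA.1.spectrum_real_eq_range_eigenvalues] at hx
  obtain ⟨i, rfl⟩ := hx
  exact hA.eigenvalues_pos i

lemma posDef_cfc {A : Matrix ι ι ℂ} (hA : A.PosDef) {f : ℝ → ℝ} (hf : ∀ x, 0 < x → 0 < f x) :
    (cfc f A).PosDef := by
  rw [hA.1.cfc_eq, IsHermitian.cfc, Unitary.conjStarAlgAut_apply,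
    IsUnit.posDef_star_right_conjugate_iff Unitary.isUnit_coe, posDef_diagonal_iff]
  intro i
  simpa using hf _ (hA.eigenvalues_pos i)

lemma posDef_mpow {A : Matrix ι ι ℂ} (hA : A.PosDef) (r : ℝ) : (mpow A r).PosDef :=
  posDef_cfc hA fun _ hx => Real.rpow_pos_of_pos hx r

lemma mpow_mul_mpow {A : Matrix ι ι ℂ} (hA : A.PosDef) (r s : ℝ) :
    mpow A r * mpow A s = mpow A (r + s) := by
  rw [mpow, mpow, cfc_mul_cfc]
  exact cfc_congr fun x hx => (Real.rpow_add (spectrum_pos hA hx) r s).symm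

lemma mpow_zero {A : Matrix ι ι ℂ} (hA : A.PosDef) : mpow A 0 = 1 := by
  simp only [mpow, Real.rpow_zero]
  exact cfc_const_one ℝ A hA.1

lemma mpow_one {A : Matrix ι ι ℂ} (hA : A.PosDef) : mpow A 1 = A := by
  simp only [mpow, Real.rpow_one]
  exact cfc_id' ℝ A hA.1

lemma mpow_mpow {A : Matrix ι ι ℂ} (hA : A.PosDef) (r s : ℝ) :
    mpow (mpow A r) s = mpow A (r * s) := by
  rw [mpow, mpow, cfc_cfc hA.1]
  exact cfc_congr fun x hx => (Real.rpow_mul (spectrum_pos hA hx).le r s).symm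

lemma inv_mpow {A : Matrix ι ι ℂ} (hA : A.PosDef) (r : ℝ) : (mpow A r)⁻¹ = mpow A (-r) :=
  inv_eq_right_inv (by rw [mpow_mul_mpow hA, add_neg_cancel, mpow_zero hA])

/-- Simultaneous diagonalization of two positive definite matrices by congruence. -/
lemma exists_simultaneous_congruence {A B : Matrix ι ι ℂ} (hA : A.PosDef) (hB : B.PosDef) :
    ∃ (S T : Matrix ι ι ℂ) (l : ι → ℝ), (∀ i, 0 < l i) ∧ S * T = 1 ∧ A = S * Sᴴ ∧
      B = S * diagonal (fun i => (l i : ℂ)) * Sᴴ := by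
  set R := mpow A (1 / 2)
  set Q := mpow A (-(1 / 2))
  have hRR : R * R = A := by rw [mpow_mul_mpow hA, add_halves, mpow_one hA]
  have hRQ : R * Q = 1 := by rw [mpow_mul_mpow hA, add_neg_cancel, mpow_zero hA]
  have hQR : Q * R = 1 := by rw [mpow_mul_mpow hA, neg_add_cancel, mpow_zero hA]
  have hR : Rᴴ = R := (posDef_mpow hA _).1
  have hQ : Qᴴ = Q := (posDef_mpow hA _).1
  have hM : (Qᴴ * B * Q).PosDef := hB.conjTranspose_mul_mul_same <| by
    intro x y hxy
    simpa [mulVec_mulVec, hRQ] using congrArg (R *ᵥ ·) hxy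
  set U : Matrix ι ι ℂ := (hM.1.eigenvectorUnitary : Matrix ι ι ℂ)
  have hU : U * Uᴴ = 1 := mem_unitaryGroup_iff.1 hM.1.eigenvectorUnitary.2
  have hdiag := spectral_conj hM.1
  refine ⟨R * U, Uᴴ * Q, hM.1.eigenvalues, hM.eigenvalues_pos, ?_, ?_, ?_⟩
  · rw [Matrix.mul_assoc, ← Matrix.mul_assoc U, hU, Matrix.one_mul, hRQ]
  · rw [conjTranspose_mul, hR, Matrix.mul_assoc, ← Matrix.mul_assoc U, hU, Matrix.one_mul, hRR]
  · calc B = (R * Q) * B * (Q * R) := by rw [hRQ, hQR, Matrix.one_mul, Matrix.mul_one]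
      _ = R * (Qᴴ * B * Q) * R := by rw [hQ]; simp only [Matrix.mul_assoc]
      _ = R * (U * diagonal (fun i => (hM.1.eigenvalues i : ℂ)) * Uᴴ) * R :=
        congrArg (fun M => R * M * R) hdiag
      _ = _ := by
        rw [conjTranspose_mul, hR]
        simp only [Matrix.mul_assoc]

omit [DecidableEq ι] in
lemma sum_mul_rpow_le {w l : ι → ℝ} (hw : ∀ k, 0 ≤ w k) (hl : ∀ k, 0 ≤ l k) {a b : ℝ}
    (ha : 0 < a) (hb : 0 < b) (hab : a + b = 1) :
    ∑ k, w k * l k ^ b ≤ (∑ k, w k) ^ a * (∑ k, w k * l k) ^ b := by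
  simpa using sum_rpow_le_of_le_geom (r := 1) (r₀ := 1) (r₁ := 1) (c := fun _ => 1) (e := l)
    (g := fun k => l k ^ b) hw (fun _ => zero_le_one) hl (fun k => Real.rpow_nonneg (hl k) _)
    ha hb one_pos one_pos one_pos (by simpa using hab) (fun k => by simp)

/-- A weighted geometric mean of positive definite matrices whose quadratic form, and that of its
inverse, are bounded by the geometric means of the quadratic forms. -/
lemma exists_geometric_mean {A B : Matrix ι ι ℂ} (hA : A.PosDef) (hB : B.PosDef) {a b : ℝ}
    (ha : 0 < a) (hb : 0 < b) (hab : a + b = 1) :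
    ∃ G : Matrix ι ι ℂ, G.PosDef ∧ (∀ v, quadRe G v ≤ quadRe A v ^ a * quadRe B v ^ b) ∧
      ∀ v, quadRe G⁻¹ v ≤ quadRe A⁻¹ v ^ a * quadRe B⁻¹ v ^ b := by
  obtain ⟨S, T, l, hl, hST, hAS, hBS⟩ := exists_simultaneous_congruence hA hB
  have hTS : T * S = 1 := mul_eq_one_comm.1 hST
  have hTS' : Sᴴ * Tᴴ = 1 := by rw [← conjTranspose_mul, hTS, conjTranspose_one]
  let D (f : ι → ℝ) : Matrix ι ι ℂ := S * diagonal (fun i => (f i : ℂ)) * Sᴴ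
  have hAD : A = D fun _ => 1 := by simpa [D] using hAS
  have hBD : B = D l := hBS
  have hq (f : ι → ℝ) (v : ι → ℂ) :
      quadRe (D f) v = ∑ i, Complex.normSq ((Sᴴ *ᵥ v) i) * f i := by
    rw [← quadRe_diagonal, ← quadRe_conj, conjTranspose_conjTranspose]
  have hinv (f : ι → ℝ) (hf : ∀ i, 0 < f i) :
      (D f)⁻¹ = Tᴴ * diagonal (fun i => (((f i)⁻¹ : ℝ) : ℂ)) * T := by
    refine inv_eq_right_inv ?_
    calc D f * (Tᴴ * diagonal (fun i => (((f i)⁻¹ : ℝ) : ℂ)) * T)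
        = S * (diagonal (fun i => (f i : ℂ)) * (Sᴴ * Tᴴ) *
          diagonal (fun i => (((f i)⁻¹ : ℝ) : ℂ))) * T := by simp only [D, Matrix.mul_assoc]
      _ = 1 := by
        rw [hTS', Matrix.mul_one, diagonal_mul_diagonal]
        have : (fun i => (f i : ℂ) * (((f i)⁻¹ : ℝ) : ℂ)) = fun _ => 1 := by
          funext i
          rw [← Complex.ofReal_mul, mul_inv_cancel₀ (hf i).ne', Complex.ofReal_one]
        rw [this, diagonal_one, Matrix.mul_one, hST]
  have hqinv (f : ι → ℝ) (hf : ∀ i, 0 < f i) (v : ι → ℂ) :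
      quadRe (D f)⁻¹ v = ∑ i, Complex.normSq ((T *ᵥ v) i) * (f i)⁻¹ := by
    rw [hinv f hf, quadRe_conj, quadRe_diagonal]
  have hlb (i : ι) : 0 < l i ^ b := Real.rpow_pos_of_pos (hl i) b
  refine ⟨D fun i => l i ^ b, ?_, fun v => ?_, fun v => ?_⟩
  · refine (IsUnit.posDef_star_right_conjugate_iff (IsUnit.of_mul_eq_one T hST)).2 ?_
    exact posDef_diagonal_iff.2 fun i => by exact_mod_cast hlb i
  · rw [hAD, hBD, hq, hq, hq]
    simpa using sum_mul_rpow_le (fun k => Complex.normSq_nonneg ((Sᴴ *ᵥ v) k))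
      (fun k => (hl k).le) ha hb hab
  · rw [hAD, hBD, hqinv _ hlb, hqinv _ (fun _ => one_pos), hqinv _ hl]
    simpa [Real.inv_rpow (hl _).le] using
      sum_mul_rpow_le (l := fun i => (l i)⁻¹) (fun k => Complex.normSq_nonneg ((T *ᵥ v) k))
      (fun k => (inv_pos.2 (hl k)).le) ha hb hab

/-- A sandwiched trace in terms of a fixed square root of the inner matrix. -/
lemma trR_mpow_sandwich {A B : Matrix ι ι ℂ} (hA : A.PosDef) (hB : B.PosDef) (t r : ℝ) :
    trR (mpow (mpow A t * B * mpow A t) r) =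
      trR (mpow ((mpow B (1 / 2))ᴴ * mpow A (t + t) * mpow B (1 / 2)) r) := by
  have hAt : (mpow A t)ᴴ = mpow A t := (posDef_mpow hA t).1
  have hBL : (mpow B (1 / 2))ᴴ = mpow B (1 / 2) := (posDef_mpow hB _).1
  refine trR_mpow_congr ?_ ?_ ?_ r
  · have := isHermitian_conjTranspose_mul_mul (mpow A t) hB.1
    rwa [hAt] at this
  · exact isHermitian_conjTranspose_mul_mul _ (posDef_mpow hA _).1
  · rw [hBL, ← mpow_mul_mpow hA]
    conv_lhs => rw [← mpow_one hB, ← add_halves (1 : ℝ), ← mpow_mul_mpow hB]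
    rw [← Matrix.mul_assoc, Matrix.mul_assoc, charpoly_mul_comm]
    simp only [Matrix.mul_assoc]

lemma posSemidef_cfc {A : Matrix ι ι ℂ} (hA : A.IsHermitian) {f : ℝ → ℝ}
    (hf : ∀ i, 0 ≤ f (hA.eigenvalues i)) : (cfc f A).PosSemidef := by
  rw [hA.cfc_eq, IsHermitian.cfc, Unitary.conjStarAlgAut_apply,
    IsUnit.posSemidef_star_right_conjugate_iff Unitary.isUnit_coe, posSemidef_diagonal_iff]
  intro i
  simpa using hf i

lemma trace_eq_ofReal_trR {A : Matrix ι ι ℂ} (hA : A.IsHermitian) : A.trace = (trR A : ℂ) := by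
  rw [trR, hA.trace_eq_sum_eigenvalues]
  simp

lemma trR_eq_sum_eigenvalues {A : Matrix ι ι ℂ} (hA : A.IsHermitian) :
    trR A = ∑ i, hA.eigenvalues i := by
  rw [trR, hA.trace_eq_sum_eigenvalues]
  simp

lemma one_le_trR_conj_mpow {A L : Matrix ι ι ℂ} (hA : A.PosDef) (hA1 : A.trace = 1)
    (hL : (Lᴴ * L).trace = 1) {s : ℝ} (hs : s ≤ 0) : 1 ≤ trR (Lᴴ * mpow A s * L) := by
  have hsum : ∑ i, hA.1.eigenvalues i = 1 := by
    rw [← trR_eq_sum_eigenvalues, trR, hA1, Complex.one_re]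
  have hev (i : ι) : hA.1.eigenvalues i ≤ 1 := by
    rw [← hsum]
    exact Finset.single_le_sum (fun j _ => (hA.eigenvalues_pos j).le) (Finset.mem_univ i)
  set D : Matrix ι ι ℂ := cfc (fun x : ℝ => x ^ s - 1) A with hD
  have hDp : D.PosSemidef := posSemidef_cfc hA.1 fun i =>
    sub_nonneg.2 (Real.one_le_rpow_of_pos_of_le_one_of_nonpos (hA.eigenvalues_pos i) (hev i) hs)
  have hdec : mpow A s = 1 + D := by
    have hsub : D = mpow A s - 1 :=
      (cfc_sub (fun x : ℝ => x ^ s) (fun _ => 1) A (A.finite_real_spectrum.continuousOn _)).trans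
        (congrArg (mpow A s - ·) (cfc_const_one ℝ A hA.1))
    rw [hsub, add_sub_cancel]
  have hnn := (Complex.le_def.1 (hDp.conjTranspose_mul_mul_same L).trace_nonneg).1
  rw [hdec, Matrix.mul_add, Matrix.add_mul, Matrix.mul_one, trR, trace_add, hL, Complex.add_re,
    Complex.one_re]
  exact le_add_of_nonneg_right hnn

lemma card_rpow_le_trR_mpow [Nonempty ι] {A : Matrix ι ι ℂ} (hA : A.PosSemidef)
    (hA1 : 1 ≤ trR A) {r : ℝ} (hr : 1 ≤ r) :
    ((Fintype.card ι : ℝ) ^ (r - 1))⁻¹ ≤ trR (mpow A r) := by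
  have hcard : (0 : ℝ) < (Fintype.card ι : ℝ) ^ (r - 1) :=
    Real.rpow_pos_of_pos (by exact_mod_cast Fintype.card_pos) _
  rw [inv_le_iff_one_le_mul₀' hcard, trR_mpow hA.1]
  have h := Real.rpow_sum_le_const_mul_sum_rpow_of_nonneg Finset.univ hr
    (fun i _ => hA.eigenvalues_nonneg i)
  rw [← trR_eq_sum_eigenvalues, Finset.card_univ] at h
  exact (Real.one_le_rpow hA1 (by linarith)).trans h

/-- Interpolation between two normalized outer matrices: some normalized outer matrix at the
intermediate exponent satisfies the Hölder bound. -/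
lemma exists_density_interpolation {m : Type*} [Fintype m] {P : m → ℝ} (hP : ∀ i, 0 ≤ P i)
    (L : m → Matrix ι ι ℂ) [Nonempty ι] {σ₀ σ₁ : Matrix ι ι ℂ} (h₀ : σ₀.PosDef)
    (h₀' : σ₀.trace = 1) (h₁ : σ₁.PosDef) (h₁' : σ₁.trace = 1) {x y z a b : ℝ}
    (hx : x ∈ Set.Ioo (-1 : ℝ) 0) (hy : y ∈ Set.Ioo (-1 : ℝ) 0) (ha : 0 < a) (hb : 0 < b)
    (hab : a + b = 1) (hz : z = a * x + b * y) :
    ∃ τ : Matrix ι ι ℂ, τ.PosDef ∧ τ.trace = 1 ∧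
      ∑ i, P i * trR (mpow ((L i)ᴴ * mpow τ z * L i) (1 / (1 + z))) ≤
        (∑ i, P i * trR (mpow ((L i)ᴴ * mpow σ₀ x * L i) (1 / (1 + x)))) ^
          (a * (1 + x) / (1 + z)) *
        (∑ i, P i * trR (mpow ((L i)ᴴ * mpow σ₁ y * L i) (1 / (1 + y)))) ^
          (b * (1 + y) / (1 + z)) := by
  obtain ⟨hx1, hx0⟩ := hx
  obtain ⟨hy1, hy0⟩ := hy
  have hz0 : z < 0 := by nlinarith
  have hz1 : -1 < z := by nlinarith
  obtain ⟨G, hG, hGq, hGinv⟩ :=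
    exists_geometric_mean (posDef_mpow h₀ (-x)) (posDef_mpow h₁ (-y)) ha hb hab
  rw [inv_mpow h₀, neg_neg, inv_mpow h₁, neg_neg] at hGinv
  set c := trR (mpow G (1 / -z)) with hc
  have hcpos : 0 < c := by
    rw [hc, trR_mpow hG.1]
    exact Finset.sum_pos (fun i _ => Real.rpow_pos_of_pos (hG.eigenvalues_pos i) _)
      Finset.univ_nonempty
  have hnorm {σ : Matrix ι ι ℂ} (hσ : σ.PosDef) (hσ' : σ.trace = 1) {s : ℝ} (hs : s < 0) :
      trR (mpow (mpow σ (-s)) (1 / -s)) = 1 := by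
    rw [mpow_mpow hσ, mul_one_div_cancel (by linarith), mpow_one hσ, trR, hσ', Complex.one_re]
  have hone_le {s : ℝ} (hs : s < 0) (hs1 : -1 < s) : 1 ≤ 1 / -s := by
    rw [le_div_iff₀ (by linarith)]
    linarith
  have hc1 : c ≤ 1 := by
    have := sum_trR_mpow_le_of_quadRe_le (m := Unit) (P := fun _ => 1) (fun _ => zero_le_one)
      (fun _ => hG.posSemidef) (fun _ => (posDef_mpow h₀ (-x)).posSemidef)
      (fun _ => (posDef_mpow h₁ (-y)).posSemidef) ha hb
      (r := 1 / -z) (by have := hone_le hz0 hz1; linarith) (hone_le hx0 hx1) (hone_le hy0 hy1)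
      (by rw [hz]; simp only [div_div_eq_mul_div, div_one]; ring) (fun _ => hGq)
    simpa only [Finset.univ_unique, Finset.sum_singleton, one_mul, hnorm h₀ h₀' hx0,
      hnorm h₁ h₁' hy0, Real.one_rpow, mul_one] using this
  set τ : Matrix ι ι ℂ := cfc (fun t : ℝ => c⁻¹ * t ^ (1 / -z)) G with hτ
  have hτp : τ.PosDef := posDef_cfc hG fun t ht =>
    mul_pos (inv_pos.2 hcpos) (Real.rpow_pos_of_pos ht _)
  have hτ1 : τ.trace = 1 := by
    rw [trace_eq_ofReal_trR hτp.1, hτ, trR_cfc hG.1, ← Finset.mul_sum, ← trR_mpow hG.1, ← hc,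
      inv_mul_cancel₀ hcpos.ne', Complex.ofReal_one]
  have hτz : mpow τ z = c ^ (-z) • G⁻¹ := by
    have hGi : G⁻¹ = mpow G (-1) := by
      conv_lhs => rw [← mpow_one hG, inv_mpow hG]
    rw [hGi, hτ, mpow, cfc_cfc hG.1, mpow,
      ← cfc_smul (c ^ (-z)) (fun t : ℝ => t ^ (-1 : ℝ)) G (G.finite_real_spectrum.continuousOn _)]
    refine cfc_congr fun t ht => ?_
    have ht0 := spectrum_pos hG ht
    simp only [smul_eq_mul]
    rw [Real.mul_rpow (by positivity) (by positivity), ← Real.rpow_mul ht0.le,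
      Real.inv_rpow hcpos.le, ← Real.rpow_neg hcpos.le,
      show 1 / -z * z = -1 by rw [div_neg, neg_mul, one_div_mul_cancel hz0.ne]]
  refine ⟨τ, hτp, hτ1, ?_⟩
  have hone_le' {s : ℝ} (hs : s < 0) (hs1 : -1 < s) : 1 ≤ 1 / (1 + s) := by
    rw [le_div_iff₀ (by linarith)]
    linarith
  have key := sum_trR_mpow_le_of_quadRe_le hP
    (fun i => (posDef_mpow hτp z).posSemidef.conjTranspose_mul_mul_same (L i))
    (fun i => (posDef_mpow h₀ x).posSemidef.conjTranspose_mul_mul_same (L i))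
    (fun i => (posDef_mpow h₁ y).posSemidef.conjTranspose_mul_mul_same (L i)) ha hb
    (r := 1 / (1 + z)) (by have := hone_le' hz0 hz1; linarith) (hone_le' hx0 hx1)
    (hone_le' hy0 hy1)
    (by rw [hz]; simp only [div_div_eq_mul_div, div_one]; linear_combination hab)
    (fun i v => by
      rw [quadRe_conj, quadRe_conj, quadRe_conj, hτz, quadRe_smul]
      refine le_trans ?_ (hGinv _)
      exact mul_le_of_le_one_left (quadRe_nonneg hG.inv.posSemidef _)
        (Real.rpow_le_one hcpos.le hc1 (by linarith)))
  have hexp (e s : ℝ) : e * (1 / (1 + z)) / (1 / (1 + s)) = e * (1 + s) / (1 + z) := by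
    rw [div_div_eq_mul_div, div_one]
    ring
  rwa [hexp, hexp] at key

end Helpers

/-- concavity of the sandwiched Rényi auxiliary function
`E₀^{(1),*}(s,P) = s·I^{(1),*}_{1/(1+s)}(P,W)` on `(-1,0)`. -/
theorem sandwiched_renyi_auxiliary_concave {d n : ℕ} (hd : 0 < d) (hn : 0 < n)
    (W : Fin n → Matrix (Fin d) (Fin d) ℂ)
    (hW : ∀ i, (W i).PosDef ∧ (W i).trace = 1)
    (P : Fin n → ℝ) (hP : ∀ i, 0 ≤ P i) (hP1 : ∑ i, P i = 1) :
    ConcaveOn ℝ (Set.Ioo (-1 : ℝ) 0)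
      (fun s => s * sandwichedRenyiInfo (1 / (1 + s)) W P) := by
  have : Nonempty (Fin d) := ⟨⟨0, hd⟩⟩
  have : Nonempty (Dens d) := ⟨⟨W ⟨0, hn⟩, hW _⟩⟩
  let L (i : Fin n) : Matrix (Fin d) (Fin d) ℂ := mpow (W i) (1 / 2)
  have hL (i : Fin n) : ((L i)ᴴ * L i).trace = 1 := by
    have hLi : (L i)ᴴ = L i := (posDef_mpow (hW i).1 _).1
    rw [hLi, mpow_mul_mpow (hW i).1, add_halves, mpow_one (hW i).1, (hW i).2]
  let Q (s : ℝ) (σ : Dens d) : ℝ :=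
    ∑ i, P i * trR (mpow ((L i)ᴴ * mpow σ.1 s * L i) (1 / (1 + s)))
  have hI {s : ℝ} (hs : s ∈ Set.Ioo (-1 : ℝ) 0) : sandwichedRenyiInfo (1 / (1 + s)) W P =
      ⨅ σ : Dens d, (1 / (1 / (1 + s) - 1)) * Real.log (Q s σ) := by
    have h1 : 1 + s ≠ 0 := by linarith [hs.1]
    have he : (1 - 1 / (1 + s)) / (2 * (1 / (1 + s))) + (1 - 1 / (1 + s)) / (2 * (1 / (1 + s)))
        = s := by
      field_simp
      ring
    refine iInf_congr fun σ => congrArg (fun q => 1 / (1 / (1 + s) - 1) * Real.log q) <|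
      Finset.sum_congr rfl fun i _ => ?_
    rw [trR_mpow_sandwich σ.2.1 (hW _).1, he]
  have hQ {s : ℝ} (hs : s ∈ Set.Ioo (-1 : ℝ) 0) (σ : Dens d) :
      ((Fintype.card (Fin d) : ℝ) ^ (1 / (1 + s) - 1))⁻¹ ≤ Q s σ := by
    have h1 : 1 ≤ 1 / (1 + s) := by
      rw [le_div_iff₀ (by linarith [hs.1])]
      linarith [hs.2]
    set c := ((Fintype.card (Fin d) : ℝ) ^ (1 / (1 + s) - 1))⁻¹
    have hc : c = ∑ i, P i * c := by rw [← Finset.sum_mul, hP1, one_mul]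
    rw [hc]
    refine Finset.sum_le_sum fun i _ => mul_le_mul_of_nonneg_left ?_ (hP i)
    exact card_rpow_le_trR_mpow
      ((posDef_mpow σ.2.1 s).posSemidef.conjTranspose_mul_mul_same (L i))
      (one_le_trR_conj_mpow σ.2.1 σ.2.2 (hL i) hs.2.le) h1
  have hlow (s : ℝ) : 0 < ((Fintype.card (Fin d) : ℝ) ^ (1 / (1 + s) - 1))⁻¹ :=
    inv_pos.2 (Real.rpow_pos_of_pos (by exact_mod_cast Fintype.card_pos) _)
  have hcoef {s : ℝ} (hs : s ∈ Set.Ioo (-1 : ℝ) 0) :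
      s * (1 / (1 / (1 + s) - 1)) = -(1 + s) := by
    have h1 : 1 + s ≠ 0 := by linarith [hs.1]
    have h2 : s ≠ 0 := hs.2.ne
    rw [show 1 / (1 + s) - 1 = -s / (1 + s) by field_simp; ring]
    field_simp
  have hsup {s : ℝ} (hs : s ∈ Set.Ioo (-1 : ℝ) 0) : s * sandwichedRenyiInfo (1 / (1 + s)) W P =
      ⨆ σ : Dens d, -(1 + s) * Real.log (Q s σ) := by
    rw [hI hs, Real.mul_iInf_of_nonpos hs.2.le]
    simp only [← mul_assoc, hcoef hs]
  have hbdd {s : ℝ} (hs : s ∈ Set.Ioo (-1 : ℝ) 0) :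
      BddAbove (Set.range fun σ : Dens d => -(1 + s) * Real.log (Q s σ)) := by
    refine ⟨-(1 + s) * Real.log ((Fintype.card (Fin d) : ℝ) ^ (1 / (1 + s) - 1))⁻¹, ?_⟩
    rintro _ ⟨σ, rfl⟩
    exact mul_le_mul_of_nonpos_left (Real.log_le_log (hlow s) (hQ hs σ)) (by linarith [hs.1])
  refine concaveOn_iff_forall_pos.2 ⟨convex_Ioo _ _, fun x hx y hy a b ha hb hab => ?_⟩
  have hz : a • x + b • y ∈ Set.Ioo (-1 : ℝ) 0 := convex_Ioo _ _ hx hy ha.le hb.le hab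
  simp only [smul_eq_mul] at hz ⊢
  rw [hsup hx, hsup hy, hsup hz, Real.mul_iSup_of_nonneg ha.le, Real.mul_iSup_of_nonneg hb.le]
  refine ciSup_add_ciSup_le fun σ₀ σ₁ => ?_
  obtain ⟨τ, hτ, hτ', hle⟩ := exists_density_interpolation hP L σ₀.2.1 σ₀.2.2 σ₁.2.1 σ₁.2.2
    hx hy ha hb hab rfl
  refine le_trans ?_ (le_ciSup (hbdd hz) ⟨τ, hτ, hτ'⟩)
  have hz1 : 0 < 1 + (a * x + b * y) := by linarith [hz.1]
  have hQx : 0 < Q x σ₀ := (hlow x).trans_le (hQ hx σ₀)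
  have hQy : 0 < Q y σ₁ := (hlow y).trans_le (hQ hy σ₁)
  have hlog := Real.log_le_log ((hlow _).trans_le (hQ hz ⟨τ, hτ, hτ'⟩)) hle
  rw [Real.log_mul (Real.rpow_pos_of_pos hQx _).ne' (Real.rpow_pos_of_pos hQy _).ne',
    Real.log_rpow hQx, Real.log_rpow hQy] at hlog
  have hmul := mul_le_mul_of_nonneg_left hlog hz1.le
  have hrhs (u v : ℝ) : (1 + (a * x + b * y)) * (a * (1 + x) / (1 + (a * x + b * y)) * u +
      b * (1 + y) / (1 + (a * x + b * y)) * v) = a * (1 + x) * u + b * (1 + y) * v := by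
    field_simp
  rw [hrhs] at hmul
  simp only [Q] at hmul ⊢
  linarith
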